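/- Let p ∈ (1,2] and φ(t) = t + (1/2)·log(t²), and for τ > 0 define the conjugated operator L_τ v = ∂_t v + i·∂_θ v + τ·(1 + 1/t)·v and the low-frequency projection P^l_τ = Σ_{k=0}^{⌈2τ⌉} P_k (acting in the θ-variable). Then there exist t₀ < 0, τ₀ > 0, and a constant C = C(p,t₀) > 0 such that for every τ ≥ τ₀ and every smooth v : ℝ × S¹ → ℂ with compact support contained in (−∞, t₀) × S¹: ‖t^{−1}·P^l_τ v‖_{L²(dt dθ)} ≤ C·τ^{−1+1/p}·‖t·L_τ v‖_{L^p(dt dθ)}. -/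

import Mathlib

open MeasureTheory Metric Complex ENNReal

noncomputable section

/-- Partial derivative in `t` of a function on `ℝ × S¹` (viewed as `ℝ × ℝ`). -/
def dT (v : ℝ × ℝ → ℂ) (q : ℝ × ℝ) : ℂ := deriv (fun s => v (s, q.2)) q.1

/-- Partial derivative in `θ` of a function on `ℝ × S¹` (viewed as `ℝ × ℝ`). -/
def dTh (v : ℝ × ℝ → ℂ) (q : ℝ × ℝ) : ℂ := deriv (fun s => v (q.1, s)) q.2

/-- The region `ℝ × [0, 2π)`, a fundamental domain for `ℝ × S¹`. -/
def stripe : Set (ℝ × ℝ) := Set.univ ×ˢ Set.Ico 0 (2 * Real.pi)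

/-- The conjugated operator `L_τ v = ∂_t v + i ∂_θ v + τ(1 + 1/t) v`. -/
def Ltau (τ : ℝ) (v : ℝ × ℝ → ℂ) (q : ℝ × ℝ) : ℂ :=
  dT v q + Complex.I * dTh v q + ((τ * (1 + 1 / q.1) : ℝ) : ℂ) * v q

/-- The `k`-th Fourier coefficient in `θ`:
`(1/2π) ∫₀^{2π} v(t,θ') e^{-ikθ'} dθ'`. -/
def fcT (v : ℝ × ℝ → ℂ) (k : ℤ) (t : ℝ) : ℂ :=
  (1 / (2 * Real.pi) : ℂ) *
    ∫ θ in Set.Ico (0 : ℝ) (2 * Real.pi), v (t, θ) * Complex.exp (-Complex.I * k * θ)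

/-- The projection `P_k` onto the `k`-th Fourier mode in `θ`. -/
def Pk (v : ℝ × ℝ → ℂ) (k : ℤ) (q : ℝ × ℝ) : ℂ :=
  fcT v k q.1 * Complex.exp (Complex.I * k * q.2)

/-- The low-frequency projection `P^l_τ = Σ_{k=0}^{⌈2τ⌉} P_k`. -/
def Pl (τ : ℝ) (v : ℝ × ℝ → ℂ) (q : ℝ × ℝ) : ℂ :=
  ∑ k ∈ Finset.Icc (0 : ℤ) ⌈(2 * τ : ℝ)⌉, Pk v k q

/-- Hölder's inequality for a product of three functions. -/
lemma lintegral_mul_mul_rpow_le {α : Type*} [MeasurableSpace α] {μ : Measure α}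
    {f g h : α → ℝ≥0∞} (hf : AEMeasurable f μ) (hg : AEMeasurable g μ) (hh : AEMeasurable h μ)
    {a b c : ℝ} (ha : 0 ≤ a) (hb : 0 ≤ b) (hc : 0 ≤ c) (habc : a + b + c = 1) :
    ∫⁻ x, f x ^ a * g x ^ b * h x ^ c ∂μ ≤
      (∫⁻ x, f x ∂μ) ^ a * (∫⁻ x, g x ∂μ) ^ b * (∫⁻ x, h x ∂μ) ^ c := by
  have := ENNReal.lintegral_prod_norm_pow_le (μ := μ) Finset.univ (f := ![f, g, h])
    (p := ![a, b, c]) (by intro i _; fin_cases i <;> assumption)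
    (by simpa [Fin.sum_univ_three] using habc) (by intro i _; fin_cases i <;> assumption)
  simpa [Fin.prod_univ_three] using this

/-- Interpolated Schur test for the quadratic form of a bounded symmetric kernel. -/
lemma lintegral_lintegral_mul_mul_le {α : Type*} [MeasurableSpace α] {μ : Measure α} [SFinite μ]
    {p : ℝ} (hp1 : 1 < p) (hp2 : p ≤ 2) {f : α → ℝ≥0∞} (hf : Measurable f)
    {P : α × α → ℝ≥0∞} (hP : Measurable P) (hsymm : ∀ x y, P (x, y) = P (y, x))
    {S M : ℝ≥0∞} (hS : ∀ q, P q ≤ S) (hM : ∀ x, ∫⁻ y, P (x, y) ∂μ ≤ M) :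
    ∫⁻ q, f q.1 * f q.2 * P q ∂(μ.prod μ) ≤
      S ^ (2 / p - 1) * M ^ (2 - 2 / p) * (∫⁻ x, f x ^ p ∂μ) ^ (2 / p) := by
  have hp0 : 0 < p := by linarith
  set a : ℝ := 2 / p - 1 with ha'
  set b : ℝ := 1 - 1 / p with hb'
  have ha : 0 ≤ a := by
    rw [ha', sub_nonneg, le_div_iff₀ hp0]; linarith
  have hb : 0 ≤ b := by
    rw [hb', sub_nonneg, div_le_iff₀ hp0]; linarith
  have hab : a + b + b = 1 := by rw [ha', hb']; ring
  have hpa : p * (a + b) = 1 := by rw [ha', hb']; field_simp; ring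
  have hfm : Measurable fun x => f x ^ p := hf.pow_const p
  have hfp : ∀ x, f x = (f x ^ p) ^ a * (f x ^ p) ^ b := by
    intro x
    rw [← ENNReal.rpow_add_of_nonneg _ _ ha hb, ← ENNReal.rpow_mul, hpa, ENNReal.rpow_one]
  have hPp : ∀ q, P q ≤ S ^ a * (P q ^ b * P q ^ b) := by
    intro q
    calc P q = P q ^ a * (P q ^ b * P q ^ b) := by
          rw [← ENNReal.rpow_add_of_nonneg _ _ hb hb,
            ← ENNReal.rpow_add_of_nonneg _ _ ha (by positivity), ← add_assoc, hab,
            ENNReal.rpow_one]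
      _ ≤ _ := by gcongr; exact hS q
  have hI1 : ∫⁻ q, f q.1 ^ p * f q.2 ^ p ∂(μ.prod μ) = (∫⁻ x, f x ^ p ∂μ) ^ (2 : ℝ) := by
    rw [lintegral_prod_mul hfm.aemeasurable hfm.aemeasurable, ENNReal.rpow_two, sq]
  have hI2 : ∫⁻ q, f q.1 ^ p * P q ∂(μ.prod μ) ≤ (∫⁻ x, f x ^ p ∂μ) * M := by
    rw [lintegral_prod _ (by fun_prop), ← lintegral_mul_const _ hfm]
    refine lintegral_mono fun x => ?_
    simp only
    rw [lintegral_const_mul _ (by fun_prop)]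
    gcongr
    exact hM x
  have hI3 : ∫⁻ q, f q.2 ^ p * P q ∂(μ.prod μ) ≤ (∫⁻ x, f x ^ p ∂μ) * M := by
    rw [lintegral_prod_symm _ (by fun_prop), ← lintegral_mul_const _ hfm]
    refine lintegral_mono fun x => ?_
    simp only
    rw [lintegral_const_mul _ (by fun_prop)]
    gcongr
    simp_rw [hsymm _ x]
    exact hM x
  calc ∫⁻ q, f q.1 * f q.2 * P q ∂(μ.prod μ)
      ≤ ∫⁻ q, S ^ a * ((f q.1 ^ p * f q.2 ^ p) ^ a * (f q.1 ^ p * P q) ^ b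
          * (f q.2 ^ p * P q) ^ b) ∂(μ.prod μ) := by
        refine lintegral_mono fun q => ?_
        calc f q.1 * f q.2 * P q
            ≤ ((f q.1 ^ p) ^ a * (f q.1 ^ p) ^ b) * ((f q.2 ^ p) ^ a * (f q.2 ^ p) ^ b)
              * (S ^ a * (P q ^ b * P q ^ b)) := by
              rw [← hfp, ← hfp]; gcongr; exact hPp q
          _ = _ := by
              rw [ENNReal.mul_rpow_of_nonneg _ _ ha, ENNReal.mul_rpow_of_nonneg _ _ hb,
                ENNReal.mul_rpow_of_nonneg _ _ hb]
              ring
    _ = S ^ a * ∫⁻ q, (f q.1 ^ p * f q.2 ^ p) ^ a * (f q.1 ^ p * P q) ^ b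
          * (f q.2 ^ p * P q) ^ b ∂(μ.prod μ) := lintegral_const_mul _ (by fun_prop)
    _ ≤ S ^ a * (((∫⁻ x, f x ^ p ∂μ) ^ (2 : ℝ)) ^ a * ((∫⁻ x, f x ^ p ∂μ) * M) ^ b
          * ((∫⁻ x, f x ^ p ∂μ) * M) ^ b) := by
        gcongr
        refine (lintegral_mul_mul_rpow_le (by fun_prop) (by fun_prop) (by fun_prop)
          ha hb hb hab).trans ?_
        rw [hI1]
        gcongr
    _ = _ := by
        have e1 : 2 / p = 2 * a + b + b := by rw [ha', hb']; field_simp; ring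
        have e2 : 2 - 2 / p = b + b := by rw [hb']; ring
        rw [ENNReal.mul_rpow_of_nonneg _ _ hb, ← ENNReal.rpow_mul, e2, e1,
          ENNReal.rpow_add_of_nonneg _ _ (by positivity) hb,
          ENNReal.rpow_add_of_nonneg _ _ (by positivity) hb,
          ENNReal.rpow_add_of_nonneg _ _ (by positivity) hb]
        ring

/-- Young's convolution inequality from `L^p` to `L²`. -/
lemma lintegral_convolution_sq_le {p r : ℝ} (hp1 : 1 < p) (hp2 : p ≤ 2) (hr : 0 < r)
    (hpr : 1 / r + 1 / p = 3 / 2) {K f : ℝ → ℝ≥0∞} (hK : Measurable K) (hf : Measurable f) :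
    ∫⁻ t, (∫⁻ s, K (t - s) * f s) ^ (2 : ℝ) ≤
      (∫⁻ x, K x ^ r) ^ (2 / r) * (∫⁻ s, f s ^ p) ^ (2 / p) := by
  have hp0 : 0 < p := by linarith
  set a : ℝ := 1 / r - 1 / 2 with ha'
  set b : ℝ := 1 / p - 1 / 2 with hb'
  have hb : 0 ≤ b := by
    rw [hb', sub_nonneg]; exact one_div_le_one_div_of_le hp0 hp2
  have ha : 0 ≤ a := by
    have : 1 / p ≤ 1 := by rw [div_le_iff₀ hp0]; linarith
    rw [ha']; linarith
  have habc : 1 / 2 + a + b = 1 := by rw [ha', hb']; linarith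
  have hra : r * (1 / 2 + a) = 1 := by rw [ha']; field_simp; ring
  have hpb : p * (1 / 2 + b) = 1 := by rw [hb']; field_simp; ring
  set A := ∫⁻ x, K x ^ r
  set B := ∫⁻ s, f s ^ p
  have hpt : ∀ t, ∫⁻ s, K (t - s) * f s ≤
      (∫⁻ s, K (t - s) ^ r * f s ^ p) ^ (1 / 2 : ℝ) * A ^ a * B ^ b := by
    intro t
    have hA : A = ∫⁻ s, K (t - s) ^ r := (lintegral_sub_left_eq_self (fun x => K x ^ r) t).symm
    rw [hA]
    refine le_trans (le_of_eq ?_) (lintegral_mul_mul_rpow_le (by fun_prop) (by fun_prop)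
      (by fun_prop) (by norm_num) ha hb habc)
    refine lintegral_congr fun s => ?_
    have e1 : K (t - s) = (K (t - s) ^ r) ^ (1 / 2 : ℝ) * (K (t - s) ^ r) ^ a := by
      rw [← ENNReal.rpow_add_of_nonneg _ _ (by norm_num) ha, ← ENNReal.rpow_mul, hra,
        ENNReal.rpow_one]
    have e2 : f s = (f s ^ p) ^ (1 / 2 : ℝ) * (f s ^ p) ^ b := by
      rw [← ENNReal.rpow_add_of_nonneg _ _ (by norm_num) hb, ← ENNReal.rpow_mul, hpb,
        ENNReal.rpow_one]
    rw [ENNReal.mul_rpow_of_nonneg _ _ (by norm_num : (0 : ℝ) ≤ 1 / 2)]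
    nth_rw 1 [e1, e2]
    ring
  calc ∫⁻ t, (∫⁻ s, K (t - s) * f s) ^ (2 : ℝ)
      ≤ ∫⁻ t, ((∫⁻ s, K (t - s) ^ r * f s ^ p) ^ (1 / 2 : ℝ) * A ^ a * B ^ b) ^ (2 : ℝ) := by
        refine lintegral_mono fun t => ?_
        simp only
        gcongr
        exact hpt t
    _ = ∫⁻ t, (∫⁻ s, K (t - s) ^ r * f s ^ p) * (A ^ (2 * a) * B ^ (2 * b)) := by
        refine lintegral_congr fun t => ?_
        rw [ENNReal.mul_rpow_of_nonneg _ _ (by norm_num), ENNReal.mul_rpow_of_nonneg _ _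
          (by norm_num), ← ENNReal.rpow_mul, ← ENNReal.rpow_mul, ← ENNReal.rpow_mul]
        norm_num
        rw [mul_assoc, mul_comm a, mul_comm b]
    _ = (∫⁻ t, ∫⁻ s, K (t - s) ^ r * f s ^ p) * (A ^ (2 * a) * B ^ (2 * b)) :=
        lintegral_mul_const _ (Measurable.lintegral_prod_right'
          (f := fun q : ℝ × ℝ => K (q.1 - q.2) ^ r * f q.2 ^ p) (by fun_prop))
    _ = (A * B) * (A ^ (2 * a) * B ^ (2 * b)) := by
        congr 1
        rw [lintegral_lintegral_swap (by fun_prop)]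
        have hin : ∀ s, ∫⁻ t, K (t - s) ^ r * f s ^ p = A * f s ^ p := fun s => by
          rw [lintegral_mul_const _ (by fun_prop),
            lintegral_sub_right_eq_self (fun x => K x ^ r)]
        simp_rw [hin]
        rw [lintegral_const_mul _ (by fun_prop)]
    _ = _ := by
        have e1 : 2 / r = 1 + 2 * a := by rw [ha']; ring
        have e2 : 2 / p = 1 + 2 * b := by rw [hb']; ring
        rw [e1, e2, ENNReal.rpow_add_of_nonneg _ _ zero_le_one (by positivity),
          ENNReal.rpow_add_of_nonneg _ _ zero_le_one (by positivity), ENNReal.rpow_one,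
          ENNReal.rpow_one]
        ring

/-- Lebesgue measure on the fundamental domain `[0, 2π)` of the circle. -/
abbrev circleMeasure : Measure ℝ := volume.restrict (Set.Ico 0 (2 * Real.pi))

/-- The Poisson kernel `Σ_k ρ^|k| e^{ikx}` in closed form. -/
def poissonSum (ρ x : ℝ) : ℝ := (1 - ρ ^ 2) / normSq (1 - ρ * exp (I * x))

lemma summable_pow_natAbs {ρ : ℝ} (h0 : 0 ≤ ρ) (h1 : ρ < 1) :
    Summable fun k : ℤ => ρ ^ k.natAbs := by
  have h := summable_geometric_of_lt_one h0 h1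
  refine Summable.of_nat_of_neg ?_ ?_ <;> simpa using h

lemma norm_exp_I_mul_int_mul (k : ℤ) (x : ℝ) : ‖exp (I * k * x)‖ = 1 := by
  rw [Complex.norm_exp]; simp

lemma norm_exp_neg_I_mul_int_mul (k : ℤ) (x : ℝ) : ‖exp (-I * k * x)‖ = 1 := by
  rw [Complex.norm_exp]; simp

lemma conj_exp_neg_I_mul (k : ℤ) (x : ℝ) :
    (starRingEnd ℂ) (exp (-I * k * x)) = exp (I * k * x) := by
  rw [← Complex.exp_conj]; simp

lemma hasSum_poissonSum {ρ : ℝ} (h0 : 0 ≤ ρ) (h1 : ρ < 1) (x : ℝ) :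
    HasSum (fun k : ℤ => (ρ : ℂ) ^ k.natAbs * exp (I * k * x)) (poissonSum ρ x : ℂ) := by
  set z : ℂ := ρ * exp (I * x) with hz
  have hzn : ‖z‖ < 1 := by
    have := norm_exp_I_mul_int_mul 1 x
    simp only [Int.cast_one, mul_one] at this
    simpa [hz, this, abs_of_nonneg h0] using h1
  have hcz : (starRingEnd ℂ) z = ρ * exp (-(I * x)) := by
    rw [hz, map_mul, ← Complex.exp_conj]; simp
  have hczn : ‖(starRingEnd ℂ) z‖ < 1 := by simpa using hzn
  have hz1 : 1 - z ≠ 0 := fun h => by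
    rw [sub_eq_zero] at h; rw [← h] at hzn; simp at hzn
  have hcz1 : 1 - (starRingEnd ℂ) z ≠ 0 := fun h => by
    rw [sub_eq_zero] at h; rw [← h] at hczn; simp at hczn
  have hprod : z * (starRingEnd ℂ) z = (ρ : ℂ) ^ 2 := by
    rw [hcz, hz, mul_mul_mul_comm, ← Complex.exp_add, add_neg_cancel, Complex.exp_zero]; ring
  have key : (poissonSum ρ x : ℂ) = (1 - z)⁻¹ + (1 - (starRingEnd ℂ) z)⁻¹ * (starRingEnd ℂ) z := by
    rw [poissonSum, ofReal_div, normSq_eq_conj_mul_self, map_sub, map_one, ← hz]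
    push_cast
    rw [← hprod]
    field_simp
    ring
  rw [key]
  refine HasSum.of_nat_of_neg_add_one ?_ ?_
  · refine (congrArg (HasSum · _) (funext fun n => ?_)).mpr (hasSum_geometric_of_norm_lt_one hzn)
    rw [hz, mul_pow, ← Complex.exp_nat_mul]
    simp only [Int.natAbs_natCast, Int.cast_natCast]
    ring_nf
  · refine (congrArg (HasSum · _) (funext fun n => ?_)).mpr
      ((hasSum_geometric_of_norm_lt_one hczn).mul_right ((starRingEnd ℂ) z))
    rw [← pow_succ, hcz, mul_pow, ← Complex.exp_nat_mul]
    have : (-((n : ℤ) + 1)).natAbs = n + 1 := by omega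
    rw [this]
    push_cast
    ring_nf

lemma one_sub_le_norm_one_sub {ρ : ℝ} (h0 : 0 ≤ ρ) (x : ℝ) :
    1 - ρ ≤ ‖(1 : ℂ) - ρ * exp (I * x)‖ := by
  have h := norm_sub_norm_le (1 : ℂ) (ρ * exp (I * x))
  have := norm_exp_I_mul_int_mul 1 x
  simp only [Int.cast_one, mul_one] at this
  simpa [this, abs_of_nonneg h0] using h

lemma poissonSum_nonneg {ρ : ℝ} (h0 : 0 ≤ ρ) (h1 : ρ < 1) (x : ℝ) : 0 ≤ poissonSum ρ x :=
  div_nonneg (by nlinarith) (normSq_nonneg _)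

lemma poissonSum_le {ρ : ℝ} (h0 : 0 ≤ ρ) (h1 : ρ < 1) (x : ℝ) :
    poissonSum ρ x ≤ (1 + ρ) / (1 - ρ) := by
  have h2 : 0 < 1 - ρ := by linarith
  have h3 : (1 - ρ) ^ 2 ≤ normSq (1 - ρ * exp (I * x)) := by
    rw [normSq_eq_norm_sq]
    have := one_sub_le_norm_one_sub h0 x
    gcongr
  calc poissonSum ρ x ≤ (1 - ρ ^ 2) / (1 - ρ) ^ 2 := by
        unfold poissonSum
        have : 0 ≤ 1 - ρ ^ 2 := by nlinarith
        gcongr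
    _ = (1 + ρ) / (1 - ρ) := by field_simp; ring

lemma continuous_poissonSum {ρ : ℝ} (h0 : 0 ≤ ρ) (h1 : ρ < 1) : Continuous (poissonSum ρ) := by
  unfold poissonSum
  refine continuous_const.div (continuous_normSq.comp (by fun_prop)) fun x h => ?_
  rw [map_eq_zero] at h
  have := one_sub_le_norm_one_sub h0 x
  rw [h, norm_zero] at this
  linarith

lemma poissonSum_neg (ρ x : ℝ) : poissonSum ρ (-x) = poissonSum ρ x := by
  unfold poissonSum
  rw [← normSq_conj]
  congr 2
  simp [← Complex.exp_conj]

lemma integral_exp_int_mul (k : ℤ) :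
    ∫ θ, exp (I * k * θ) ∂circleMeasure = if k = 0 then (2 * Real.pi : ℂ) else 0 := by
  rw [integral_Ico_eq_integral_Ioc, ← intervalIntegral.integral_of_le (by positivity)]
  split_ifs with h
  · simp [h]
  · have hc : I * (k : ℂ) ≠ 0 := mul_ne_zero I_ne_zero (by exact_mod_cast h)
    rw [integral_exp_mul_complex hc]
    have : exp (I * k * ((2 * Real.pi : ℝ) : ℂ)) = 1 := by
      rw [Complex.exp_eq_one_iff]
      exact ⟨k, by push_cast; ring⟩
    rw [this]; simp

lemma integral_poissonSum {ρ : ℝ} (h0 : 0 ≤ ρ) (h1 : ρ < 1) (x : ℝ) :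
    ∫ y, poissonSum ρ (y - x) ∂circleMeasure = 2 * Real.pi := by
  have hs := hasSum_integral_of_summable_integral_norm (μ := circleMeasure)
    (F := fun (k : ℤ) (y : ℝ) => (ρ : ℂ) ^ k.natAbs * exp (I * k * (y - x : ℝ)))
    (fun k => (Continuous.integrableOn_Icc (by fun_prop)).mono_set Set.Ico_subset_Icc_self) (by
      simp only [norm_mul, norm_pow, norm_exp_I_mul_int_mul, mul_one, Complex.norm_real,
        Real.norm_eq_abs, abs_of_nonneg h0, integral_const, smul_eq_mul]
      exact (summable_pow_natAbs h0 h1).mul_left _)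
  simp_rw [fun y => (hasSum_poissonSum h0 h1 (y - x)).tsum_eq] at hs
  rw [integral_complex_ofReal] at hs
  have h2 : HasSum (fun k : ℤ => ∫ y, (ρ : ℂ) ^ k.natAbs * exp (I * k * (y - x : ℝ))
      ∂circleMeasure) (2 * Real.pi : ℂ) := by
    convert hasSum_ite_eq (0 : ℤ) (2 * Real.pi : ℂ) using 2 with k
    have : ∀ y : ℝ, (ρ : ℂ) ^ k.natAbs * exp (I * k * (y - x : ℝ)) =
        ((ρ : ℂ) ^ k.natAbs * exp (-(I * k * x))) * exp (I * k * y) := by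
      intro y
      rw [mul_assoc ((ρ : ℂ) ^ _), ← Complex.exp_add]
      congr 2
      push_cast; ring
    simp_rw [this]
    rw [integral_const_mul, integral_exp_int_mul]
    split_ifs with h
    · simp [h]
    · simp
  have := hs.unique h2
  exact_mod_cast this

lemma lintegral_poissonSum {ρ : ℝ} (h0 : 0 ≤ ρ) (h1 : ρ < 1) (x : ℝ) :
    ∫⁻ y, ENNReal.ofReal (poissonSum ρ (y - x)) ∂circleMeasure =
      ENNReal.ofReal (2 * Real.pi) := by
  rw [← integral_poissonSum h0 h1 x, ofReal_integral_eq_lintegral_ofReal]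
  · have := continuous_poissonSum h0 h1
    exact (Continuous.integrableOn_Icc (by fun_prop)).mono_set Set.Ico_subset_Icc_self
  · exact Filter.Eventually.of_forall fun y => poissonSum_nonneg h0 h1 _

/-- The Fourier integral of `g` at frequency `k`, without normalization. -/
def fourierInt (g : ℝ → ℂ) (k : ℤ) : ℂ := ∫ θ, g θ * exp (-I * k * θ) ∂circleMeasure

lemma integrable_circle {g : ℝ → ℂ} (hg : Continuous g) : Integrable g circleMeasure :=
  hg.integrableOn_Icc.mono_set Set.Ico_subset_Icc_self

lemma sum_pow_natAbs_mul_norm_sq_le_lintegral {ρ : ℝ} (h0 : 0 ≤ ρ) (h1 : ρ < 1) {g : ℝ → ℂ}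
    (hg : Continuous g) (F : Finset ℤ) :
    ENNReal.ofReal (∑ k ∈ F, ρ ^ k.natAbs * ‖fourierInt g k‖ ^ 2) ≤
      ∫⁻ q, ‖g q.1‖ₑ * ‖g q.2‖ₑ * ENNReal.ofReal (poissonSum ρ (q.2 - q.1))
        ∂(circleMeasure.prod circleMeasure) := by
  have hgc : Continuous fun y => (starRingEnd ℂ) (g y) := continuous_conj.comp hg
  set T : ℤ → ℝ × ℝ → ℂ := fun k q =>
    (g q.1 * exp (-I * k * q.1)) * ((starRingEnd ℂ) (g q.2) * exp (I * k * q.2))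
      * (ρ : ℂ) ^ k.natAbs with hT
  have hTint : ∀ k, Integrable (T k) (circleMeasure.prod circleMeasure) := fun k =>
    ((integrable_circle (g := fun x => g x * exp (-I * k * x)) (by fun_prop)).mul_prod
      (integrable_circle (g := fun y => (starRingEnd ℂ) (g y) * exp (I * k * y))
        (by fun_prop))).mul_const _
  have hTval : ∀ k, ∫ q, T k q ∂(circleMeasure.prod circleMeasure) =
      ((ρ ^ k.natAbs * ‖fourierInt g k‖ ^ 2 : ℝ) : ℂ) := by
    intro k
    rw [hT]
    simp only
    rw [integral_mul_const, integral_prod_mul (fun x : ℝ => g x * exp (-I * k * x))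
      (fun y : ℝ => (starRingEnd ℂ) (g y) * exp (I * k * y))]
    have : ∫ y, (starRingEnd ℂ) (g y) * exp (I * k * y) ∂circleMeasure =
        (starRingEnd ℂ) (fourierInt g k) := by
      rw [fourierInt, ← integral_conj]
      simp_rw [map_mul, conj_exp_neg_I_mul]
    rw [this, ← fourierInt, mul_conj, normSq_eq_norm_sq]
    push_cast; ring
  have hTnorm : ∀ k q, ‖T k q‖ = ‖g q.1‖ * ‖g q.2‖ * ρ ^ k.natAbs := by
    intro k q
    simp only [hT, norm_mul, norm_pow, norm_exp_I_mul_int_mul, norm_exp_neg_I_mul_int_mul,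
      mul_one, Complex.norm_real, Real.norm_eq_abs, abs_of_nonneg h0, RCLike.norm_conj]
  have hs := hasSum_integral_of_summable_integral_norm hTint (by
    simp_rw [hTnorm, integral_mul_const]
    exact (summable_pow_natAbs h0 h1).mul_left _)
  have htsum : ∀ q, ∑' k, T k q =
      g q.1 * (starRingEnd ℂ) (g q.2) * (poissonSum ρ (q.2 - q.1) : ℂ) := by
    intro q
    rw [← (hasSum_poissonSum h0 h1 (q.2 - q.1)).tsum_eq, ← tsum_mul_left]
    refine tsum_congr fun k => ?_
    have : exp (I * k * ((q.2 - q.1 : ℝ) : ℂ)) = exp (-I * k * q.1) * exp (I * k * q.2) := by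
      rw [← Complex.exp_add]; congr 1; push_cast; ring
    rw [this]; ring
  simp_rw [hTval, htsum] at hs
  have hre := (Complex.hasSum_re hs)
  simp only [ofReal_re] at hre
  have hle := sum_le_hasSum F (fun k _ => by positivity) hre
  calc _ ≤ ENNReal.ofReal ‖∫ q, g q.1 * (starRingEnd ℂ) (g q.2) * (poissonSum ρ (q.2 - q.1) : ℂ)
          ∂(circleMeasure.prod circleMeasure)‖ :=
        ENNReal.ofReal_le_ofReal (hle.trans (Complex.re_le_norm _))
    _ ≤ ∫⁻ q, ‖g q.1 * (starRingEnd ℂ) (g q.2) * (poissonSum ρ (q.2 - q.1) : ℂ)‖ₑ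
          ∂(circleMeasure.prod circleMeasure) := by
        rw [ofReal_norm]; exact enorm_integral_le_lintegral_enorm _
    _ = _ := by
        refine lintegral_congr fun q => ?_
        rw [enorm_mul, enorm_mul, ← ofReal_norm (poissonSum _ _ : ℂ), Complex.norm_real,
          Real.norm_of_nonneg (poissonSum_nonneg h0 h1 _), ← ofReal_norm
          ((starRingEnd ℂ) (g q.2)), RCLike.norm_conj, ofReal_norm]

/-- A weighted `L^p`–`ℓ²` bound for Fourier coefficients with weights decaying geometrically
away from a frequency `m`. -/
lemma sum_pow_natAbs_sub_mul_norm_sq_le {p : ℝ} (hp1 : 1 < p) (hp2 : p ≤ 2) {ρ : ℝ} (h0 : 0 ≤ ρ)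
    (h1 : ρ < 1) {g : ℝ → ℂ} (hg : Continuous g) (F : Finset ℤ) (m : ℤ) :
    ENNReal.ofReal (∑ k ∈ F, ρ ^ (k - m).natAbs * ‖fourierInt g k‖ ^ 2) ≤
      ENNReal.ofReal ((1 + ρ) / (1 - ρ)) ^ (2 / p - 1) *
        ENNReal.ofReal (2 * Real.pi) ^ (2 - 2 / p) *
        (∫⁻ θ, ‖g θ‖ₑ ^ p ∂circleMeasure) ^ (2 / p) := by
  set h : ℝ → ℂ := fun θ => g θ * exp (-I * m * θ) with hh
  have hhc : Continuous h := by fun_prop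
  have hnorm : ∀ θ, ‖h θ‖ₑ = ‖g θ‖ₑ := fun θ => by
    rw [← ofReal_norm, ← ofReal_norm, hh, norm_mul,
      norm_exp_neg_I_mul_int_mul, mul_one]
  have hF : ∀ k, fourierInt g k = fourierInt h (k - m) := by
    intro k
    unfold fourierInt
    congr 1
    ext θ
    simp only [hh]
    rw [mul_assoc (g θ), ← Complex.exp_add]
    congr 2
    push_cast; ring
  have hsum : ∑ k ∈ F, ρ ^ (k - m).natAbs * ‖fourierInt g k‖ ^ 2 =
      ∑ k ∈ F.map (Equiv.subRight m).toEmbedding, ρ ^ k.natAbs * ‖fourierInt h k‖ ^ 2 := by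
    rw [Finset.sum_map]
    refine Finset.sum_congr rfl fun k _ => ?_
    rw [hF]; rfl
  rw [hsum]
  refine (sum_pow_natAbs_mul_norm_sq_le_lintegral h0 h1 hhc _).trans ?_
  simp_rw [hnorm]
  have hc := continuous_poissonSum h0 h1
  refine lintegral_lintegral_mul_mul_le hp1 hp2 hg.measurable.enorm
    (P := fun q => ENNReal.ofReal (poissonSum ρ (q.2 - q.1))) (by fun_prop) ?_ ?_ ?_
  · intro x y
    simp only
    rw [← poissonSum_neg, neg_sub]
  · exact fun q => ENNReal.ofReal_le_ofReal (poissonSum_le h0 h1 _)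
  · exact fun x => (lintegral_poissonSum h0 h1 x).le

/-- Parseval's identity for trigonometric polynomials. -/
lemma lintegral_enorm_sum_exp_sq (F : Finset ℤ) (c : ℤ → ℂ) :
    ∫⁻ θ, ‖∑ k ∈ F, c k * exp (I * k * θ)‖ₑ ^ (2 : ℝ) ∂circleMeasure =
      ENNReal.ofReal (2 * Real.pi * ∑ k ∈ F, ‖c k‖ ^ 2) := by
  have hint : ∫ θ, ‖∑ k ∈ F, c k * exp (I * k * θ)‖ ^ 2 ∂circleMeasure =
      2 * Real.pi * ∑ k ∈ F, ‖c k‖ ^ 2 := by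
    have hexp : ∀ θ : ℝ, ((‖∑ k ∈ F, c k * exp (I * k * θ)‖ ^ 2 : ℝ) : ℂ) =
        ∑ k ∈ F, ∑ j ∈ F, c k * (starRingEnd ℂ) (c j) * exp (I * (k - j : ℤ) * θ) := by
      intro θ
      rw [← normSq_eq_norm_sq, ← mul_conj, map_sum, Finset.sum_mul_sum]
      refine Finset.sum_congr rfl fun k _ => Finset.sum_congr rfl fun j _ => ?_
      have : exp (I * (k - j : ℤ) * θ) = exp (I * k * θ) * (starRingEnd ℂ) (exp (I * j * θ)) := by
        rw [← Complex.exp_conj, ← Complex.exp_add]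
        congr 1
        simp
        ring
      rw [this, map_mul]
      ring
    have hcast : ((∫ θ, ‖∑ k ∈ F, c k * exp (I * k * θ)‖ ^ 2 ∂circleMeasure : ℝ) : ℂ) =
        ((2 * Real.pi * ∑ k ∈ F, ‖c k‖ ^ 2 : ℝ) : ℂ) := by
      rw [← integral_complex_ofReal]
      simp_rw [hexp]
      rw [integral_finsetSum _ fun k _ => integrable_circle (by fun_prop)]
      push_cast [-Int.cast_sub]
      rw [Finset.mul_sum]
      refine Finset.sum_congr rfl fun k hk => ?_
      rw [integral_finsetSum _ fun j _ => integrable_circle (by fun_prop)]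
      rw [Finset.sum_eq_single_of_mem k hk]
      · rw [integral_const_mul, integral_exp_int_mul, mul_conj, normSq_eq_norm_sq]
        simp; ring
      · intro j _ hjk
        rw [integral_const_mul, integral_exp_int_mul, if_neg (by omega), mul_zero]
    exact_mod_cast hcast
  rw [← hint, ofReal_integral_eq_lintegral_ofReal]
  · refine lintegral_congr fun θ => ?_
    rw [ENNReal.ofReal_pow (norm_nonneg _), ofReal_norm, ENNReal.rpow_two]
  · exact (Continuous.integrableOn_Icc (by fun_prop)).mono_set Set.Ico_subset_Icc_self
  · exact Filter.Eventually.of_forall fun θ => by positivity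

lemma dT_eq {v : ℝ × ℝ → ℂ} (hv : ContDiff ℝ (⊤ : ℕ∞) v) (q : ℝ × ℝ) :
    HasDerivAt (fun s => v (s, q.2)) (fderiv ℝ v q (1, 0)) q.1 ∧ dT v q = fderiv ℝ v q (1, 0) := by
  have h : HasDerivAt (fun s => v (s, q.2)) (fderiv ℝ v q (1, 0)) q.1 :=
    HasFDerivAt.comp_hasDerivAt q.1 (hv.differentiable (by simp) _).hasFDerivAt
      ((hasDerivAt_id q.1).prodMk (hasDerivAt_const q.1 q.2))
  exact ⟨h, h.deriv⟩

lemma dTh_eq {v : ℝ × ℝ → ℂ} (hv : ContDiff ℝ (⊤ : ℕ∞) v) (q : ℝ × ℝ) :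
    HasDerivAt (fun s => v (q.1, s)) (fderiv ℝ v q (0, 1)) q.2 ∧ dTh v q = fderiv ℝ v q (0, 1) := by
  have h : HasDerivAt (fun s => v (q.1, s)) (fderiv ℝ v q (0, 1)) q.2 :=
    HasFDerivAt.comp_hasDerivAt q.2 (hv.differentiable (by simp) _).hasFDerivAt
      ((hasDerivAt_const q.2 q.1).prodMk (hasDerivAt_id q.2))
  exact ⟨h, h.deriv⟩

lemma continuous_dT {v : ℝ × ℝ → ℂ} (hv : ContDiff ℝ (⊤ : ℕ∞) v) : Continuous (dT v) := by
  have h := hv.continuous_fderiv (by simp)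
  rw [funext fun q => (dT_eq hv q).2]
  fun_prop

lemma continuous_dTh {v : ℝ × ℝ → ℂ} (hv : ContDiff ℝ (⊤ : ℕ∞) v) : Continuous (dTh v) := by
  have h := hv.continuous_fderiv (by simp)
  rw [funext fun q => (dTh_eq hv q).2]
  fun_prop

lemma fcT_eq_fourierInt (v : ℝ × ℝ → ℂ) (k : ℤ) (t : ℝ) :
    fcT v k t = (1 / (2 * Real.pi) : ℂ) * fourierInt (fun θ => v (t, θ)) k := rfl

lemma continuous_fcT {v : ℝ × ℝ → ℂ} (hv : Continuous v) (k : ℤ) : Continuous (fcT v k) := by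
  refine continuous_const.mul ?_
  have : ∀ t : ℝ, ∫ θ in Set.Ico (0 : ℝ) (2 * Real.pi), v (t, θ) * exp (-I * k * θ) =
      ∫ θ in (0 : ℝ)..(2 * Real.pi), v (t, θ) * exp (-I * k * θ) := fun t => by
    rw [integral_Ico_eq_integral_Ioc, ← intervalIntegral.integral_of_le (by positivity)]
  simp_rw [this]
  exact intervalIntegral.continuous_parametric_intervalIntegral_of_continuous'
    (by fun_prop) _ _

lemma hasDerivAt_fcT {v : ℝ × ℝ → ℂ} (hv : ContDiff ℝ (⊤ : ℕ∞) v) (k : ℤ) (t : ℝ) :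
    HasDerivAt (fcT v k) (fcT (dT v) k t) t := by
  have hvc := hv.continuous
  have hdc := continuous_dT hv
  refine HasDerivAt.const_mul _ ?_
  obtain ⟨B, hB⟩ := (((isCompact_closedBall t 1).prod
    (isCompact_Icc (a := (0 : ℝ)) (b := 2 * Real.pi))).exists_bound_of_continuousOn
      hdc.continuousOn)
  refine (hasDerivAt_integral_of_dominated_loc_of_deriv_le (μ := circleMeasure)
    (F := fun t θ => v (t, θ) * exp (-I * k * θ)) (F' := fun t θ => dT v (t, θ) * exp (-I * k * θ))
    (bound := fun _ => B) (closedBall_mem_nhds t one_pos) ?_ ?_ ?_ ?_ ?_ ?_).2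
  · exact Filter.Eventually.of_forall fun s =>
      (Continuous.aestronglyMeasurable (by fun_prop))
  · exact integrable_circle (by fun_prop)
  · exact (Continuous.aestronglyMeasurable (by fun_prop))
  · refine (ae_restrict_iff' measurableSet_Ico).2 (Filter.Eventually.of_forall fun θ hθ s hs => ?_)
    rw [norm_mul, norm_exp_neg_I_mul_int_mul, mul_one]
    exact hB _ ⟨hs, Set.Ico_subset_Icc_self hθ⟩
  · exact integrable_const _
  · refine Filter.Eventually.of_forall fun θ s _ => HasDerivAt.mul_const ?_ _
    rw [(dT_eq hv (s, θ)).2]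
    exact (dT_eq hv (s, θ)).1

lemma fcT_dTh {v : ℝ × ℝ → ℂ} (hv : ContDiff ℝ (⊤ : ℕ∞) v)
    (hper : ∀ t θ : ℝ, v (t, θ + 2 * Real.pi) = v (t, θ)) (k : ℤ) (t : ℝ) :
    fcT (dTh v) k t = I * k * fcT v k t := by
  have hvc := hv.continuous
  have hdc := continuous_dTh hv
  have hderiv : ∀ θ : ℝ, HasDerivAt (fun θ : ℝ => v (t, θ) * exp (-I * k * θ))
      (dTh v (t, θ) * exp (-I * k * θ) + v (t, θ) * (exp (-I * k * θ) * (-I * k))) θ := by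
    intro θ
    have h1 := (dTh_eq hv (t, θ)).1
    rw [← (dTh_eq hv (t, θ)).2] at h1
    refine h1.mul ?_
    have h2 : HasDerivAt (fun θ : ℝ => -I * k * (θ : ℂ)) (-I * k) θ := by
      simpa using (Complex.ofRealCLM.hasDerivAt (x := θ)).const_mul (-I * (k : ℂ))
    exact h2.cexp
  have hI := intervalIntegral.integral_eq_sub_of_hasDerivAt (a := 0) (b := 2 * Real.pi)
    (fun θ _ => hderiv θ) (Continuous.intervalIntegrable (by fun_prop) _ _)
  have hend : v (t, 2 * Real.pi) * exp (-I * k * (2 * Real.pi : ℝ)) -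
      v (t, 0) * exp (-I * k * (0 : ℝ)) = 0 := by
    have h1 := hper t 0
    rw [zero_add] at h1
    have h2 : exp (-I * k * ((2 * Real.pi : ℝ) : ℂ)) = 1 := by
      rw [Complex.exp_eq_one_iff]
      exact ⟨-k, by push_cast; ring⟩
    rw [h1, h2]; simp
  rw [hend, intervalIntegral.integral_of_le (by positivity), ← integral_Ico_eq_integral_Ioc,
    integral_add (integrable_circle (by fun_prop)) (integrable_circle (by fun_prop))] at hI
  have h3 : ∫ θ, v (t, θ) * (exp (-I * k * θ) * (-I * k)) ∂circleMeasure =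
      -(I * k) * fourierInt (fun θ => v (t, θ)) k := by
    rw [fourierInt, ← integral_const_mul]
    congr 1; ext θ; ring
  rw [h3] at hI
  change fourierInt (fun θ => dTh v (t, θ)) k + _ = 0 at hI
  rw [fcT_eq_fourierInt, fcT_eq_fourierInt]
  have h4 : fourierInt (fun θ => dTh v (t, θ)) k = I * k * fourierInt (fun θ => v (t, θ)) k := by
    linear_combination hI
  rw [h4]; ring

lemma fcT_Ltau {v : ℝ × ℝ → ℂ} (hv : ContDiff ℝ (⊤ : ℕ∞) v)
    (hper : ∀ t θ : ℝ, v (t, θ + 2 * Real.pi) = v (t, θ)) (τ : ℝ) (k : ℤ) (t : ℝ) :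
    fcT (Ltau τ v) k t = fcT (dT v) k t + ((τ * (1 + 1 / t) - k : ℝ) : ℂ) * fcT v k t := by
  have hvc := hv.continuous
  have h1 := continuous_dT hv
  have h2 := continuous_dTh hv
  have hsplit : fourierInt (fun θ => Ltau τ v (t, θ)) k =
      fourierInt (fun θ => dT v (t, θ)) k + I * fourierInt (fun θ => dTh v (t, θ)) k +
      ((τ * (1 + 1 / t) : ℝ) : ℂ) * fourierInt (fun θ => v (t, θ)) k := by
    unfold fourierInt
    rw [← integral_const_mul, ← integral_const_mul,
      ← integral_add (integrable_circle (by fun_prop)) (integrable_circle (by fun_prop)),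
      ← integral_add (integrable_circle (by fun_prop)) (integrable_circle (by fun_prop))]
    congr 1; ext θ
    simp only [Ltau]
    ring
  have h3 := fcT_dTh hv hper k t
  rw [fcT_eq_fourierInt, fcT_eq_fourierInt] at h3
  rw [fcT_eq_fourierInt, fcT_eq_fourierInt, fcT_eq_fourierInt, hsplit]
  push_cast
  linear_combination I * h3 + (k : ℂ) * (1 / (2 * Real.pi) : ℂ) *
    fourierInt (fun θ => v (t, θ)) k * I_mul_I

/-- The logarithm of the Green kernel of `∂_t + τ(1 + 1/t) - k`, split into a linear part and a
concave part. -/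
lemma phase_sub_eq {τ : ℝ} (k : ℤ) {s t : ℝ} (hs : s < 0) (ht : t < 0) :
    ((τ - k) * s + τ * Real.log s) - ((τ - k) * t + τ * Real.log t) =
      (τ * (1 + 1 / t) - k) * (s - t) - τ * (s / t - 1 - Real.log (s / t)) := by
  rw [Real.log_div hs.ne ht.ne]
  have := ht.ne
  field_simp
  ring

/-- Variation of constants for a Fourier mode, with the direction of integration chosen so that
the kernel decays. -/
lemma enorm_le_lintegral_of_ode {τ : ℝ} (k : ℤ) {w w' : ℝ → ℂ}
    (hw : ∀ t, HasDerivAt w (w' t) t) (hw' : Continuous w') {A : ℝ}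
    (hA : ∀ t ≤ A, w t = 0) (hend : ∀ t, -1 ≤ t → w t = 0) {t : ℝ} (ht : t < -1) :
    ‖w t‖ₑ ≤ ∫⁻ s in Set.Iic (-1), ENNReal.ofReal (Real.exp
        (-(|τ * (1 + 1 / t) - k| * |s - t|) - τ * (s / t - 1 - Real.log (s / t)))) *
      ‖w' s + ((τ * (1 + 1 / s) - k : ℝ) : ℂ) * w s‖ₑ := by
  have hwc : Continuous w := continuous_iff_continuousAt.2 fun t => (hw t).continuousAt
  set ψ : ℝ → ℝ := fun s => (τ - k) * s + τ * Real.log s with hψ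
  set G : ℝ → ℂ := fun s => w' s + ((τ * (1 + 1 / s) - k : ℝ) : ℂ) * w s with hG
  set E : ℝ → ℂ := fun s => ((Real.exp (ψ s - ψ t) : ℝ) : ℂ) with hE
  have hEt : E t = 1 := by simp [hE]
  have hEnorm : ∀ s, ‖E s‖ₑ = ENNReal.ofReal (Real.exp (ψ s - ψ t)) := fun s => by
    rw [← ofReal_norm, hE, Complex.norm_real, Real.norm_of_nonneg (Real.exp_pos _).le]
  have hder : ∀ s < 0, HasDerivAt (fun s => E s * w s) (E s * G s) s := by
    intro s hs
    have h1 : HasDerivAt ψ ((τ - k) + τ * s⁻¹) s := by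
      simpa using ((hasDerivAt_id' s).const_mul (τ - k)).fun_add
        ((Real.hasDerivAt_log hs.ne).const_mul τ)
    have h2 := ((h1.sub_const (ψ t)).exp.ofReal_comp).mul (hw s)
    refine h2.congr_deriv ?_
    simp only [hG, hE]
    push_cast
    ring
  have hftc : ∀ a b, a ≤ b → b ≤ -1 → E b * w b - E a * w a = ∫ s in Set.Ioc a b, E s * G s := by
    intro a b hab hb
    have hneg : ∀ s ∈ Set.uIcc a b, s < 0 := fun s hs => by
      rw [Set.uIcc_of_le hab] at hs; linarith [hs.2]
    rw [← intervalIntegral.integral_of_le hab,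
      intervalIntegral.integral_eq_sub_of_hasDerivAt (fun s hs => hder s (hneg s hs))]
    refine ContinuousOn.intervalIntegrable ?_
    have h0 : ∀ s ∈ Set.uIcc a b, s ≠ 0 := fun s hs => (hneg s hs).ne
    have hl : ContinuousOn Real.log (Set.uIcc a b) :=
      Real.continuousOn_log.mono fun s hs => h0 s hs
    have hinv : ContinuousOn (fun s : ℝ => 1 / s) (Set.uIcc a b) :=
      continuousOn_const.div continuousOn_id h0
    have hψc : ContinuousOn ψ (Set.uIcc a b) := by simp only [hψ]; fun_prop
    refine ContinuousOn.mul ?_ ?_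
    · exact Complex.continuous_ofReal.comp_continuousOn
        (Real.continuous_exp.comp_continuousOn (hψc.sub continuousOn_const))
    · refine hw'.continuousOn.add (ContinuousOn.mul ?_ hwc.continuousOn)
      exact Complex.continuous_ofReal.comp_continuousOn
        ((continuousOn_const.mul (continuousOn_const.add hinv)).sub continuousOn_const)
  have hbound : ∀ a b, b ≤ -1 →
      (∀ s ∈ Set.Ioc a b, (τ * (1 + 1 / t) - k) * (s - t) =
        -(|τ * (1 + 1 / t) - k| * |s - t|)) →
      ‖∫ s in Set.Ioc a b, E s * G s‖ₑ ≤ ∫⁻ s in Set.Iic (-1), ENNReal.ofReal (Real.exp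
        (-(|τ * (1 + 1 / t) - k| * |s - t|) - τ * (s / t - 1 - Real.log (s / t)))) * ‖G s‖ₑ := by
    intro a b hb hsign
    refine (enorm_integral_le_lintegral_enorm _).trans ?_
    refine le_trans (le_of_eq ?_) (lintegral_mono_set (fun s hs => hs.2.trans hb :
      Set.Ioc a b ⊆ Set.Iic (-1)))
    refine setLIntegral_congr_fun measurableSet_Ioc fun s hs => ?_
    rw [enorm_mul, hEnorm, ← hsign s hs,
      ← phase_sub_eq k (by linarith [hs.2] : s < 0) (by linarith : t < 0)]
  rcases le_or_gt 0 (τ * (1 + 1 / t) - k) with hκ | hκ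
  · rcases le_or_gt t A with htA | htA
    · simp [hA t htA]
    · have h := hftc A t htA.le ht.le
      rw [hA A le_rfl, hEt, mul_zero, sub_zero, one_mul] at h
      rw [h]
      refine hbound A t ht.le fun s hs => ?_
      rw [abs_of_nonneg hκ, abs_of_nonpos (by linarith [hs.2])]
      ring
  · have h := hftc t (-1) ht.le le_rfl
    rw [hend (-1) le_rfl, hEt, mul_zero, zero_sub, one_mul] at h
    rw [← enorm_neg, h]
    refine hbound t (-1) le_rfl fun s hs => ?_
    rw [abs_of_neg hκ, abs_of_pos (by linarith [hs.1])]
    ring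

lemma sub_one_sq_le_mul {x : ℝ} (hx : 0 < x) :
    (x - 1) ^ 2 ≤ 2 * (1 + x) * (x - 1 - Real.log x) := by
  obtain ⟨y, hy, rfl⟩ : ∃ y : ℝ, 0 < y ∧ x = y ^ 2 :=
    ⟨√x, Real.sqrt_pos.2 hx, (Real.sq_sqrt hx.le).symm⟩
  have hl : Real.log (y ^ 2) ≤ 2 * (y - 1) := by
    rw [Real.log_pow]
    have := Real.log_le_sub_one_of_pos hy
    push_cast; linarith
  have h1 : (y - 1) ^ 2 ≤ y ^ 2 - 1 - Real.log (y ^ 2) := by nlinarith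
  calc (y ^ 2 - 1) ^ 2 = (y + 1) ^ 2 * (y - 1) ^ 2 := by ring
    _ ≤ (2 * (1 + y ^ 2)) * (y - 1) ^ 2 := by
        gcongr; nlinarith [sq_nonneg (y - 1)]
    _ ≤ _ := by gcongr

lemma exp_neg_mul_le {τ x : ℝ} (hτ : 2 ≤ τ) (hx : 0 < x) :
    Real.exp (-τ * (x - 1 - Real.log x)) * (1 + τ * (x - 1) ^ 2) ≤ 4 * Real.exp 1 * x := by
  set h := x - 1 - Real.log x with hh
  have hh0 : 0 ≤ h := by
    have := Real.log_le_sub_one_of_pos hx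
    rw [hh]; linarith
  have e1 : Real.exp (-τ * h) = x * Real.exp (1 - x) * Real.exp (-((τ - 1) * h)) := by
    rw [show -τ * h = Real.log x + (1 - x) + -((τ - 1) * h) by rw [hh]; ring,
      Real.exp_add, Real.exp_add, Real.exp_log hx]
  have e2 : Real.exp (1 - x) * (1 + x) ≤ Real.exp 1 := by
    rw [Real.exp_sub, div_mul_eq_mul_div, div_le_iff₀ (Real.exp_pos _)]
    have := Real.add_one_le_exp x
    gcongr; linarith
  have e3 : Real.exp (1 - x) * (x - 1) ^ 2 ≤ 2 * Real.exp 1 * h := by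
    calc Real.exp (1 - x) * (x - 1) ^ 2 ≤ Real.exp (1 - x) * (2 * (1 + x) * h) := by
          gcongr; exact sub_one_sq_le_mul hx
      _ = 2 * (Real.exp (1 - x) * (1 + x)) * h := by ring
      _ ≤ _ := by gcongr
  have e4 : Real.exp (1 - x) ≤ Real.exp 1 := Real.exp_le_exp.2 (by linarith)
  have e5 : Real.exp (1 - x) * (1 + τ * (x - 1) ^ 2) ≤
      4 * Real.exp 1 * (1 + (τ - 1) * h) := by
    have h1 : Real.exp (1 - x) * (1 + τ * (x - 1) ^ 2) ≤
        Real.exp 1 + τ * (2 * Real.exp 1 * h) := by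
      calc _ = Real.exp (1 - x) + τ * (Real.exp (1 - x) * (x - 1) ^ 2) := by ring
        _ ≤ _ := by gcongr
    have h2 : τ * (2 * Real.exp 1 * h) ≤ (2 * (τ - 1)) * (2 * Real.exp 1 * h) := by
      gcongr; linarith
    nlinarith [Real.exp_pos 1]
  have e6 : (1 + (τ - 1) * h) * Real.exp (-((τ - 1) * h)) ≤ 1 := by
    rw [Real.exp_neg, ← div_eq_mul_inv, div_le_one (Real.exp_pos _)]
    linarith [Real.add_one_le_exp ((τ - 1) * h)]
  calc Real.exp (-τ * h) * (1 + τ * (x - 1) ^ 2)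
      = x * Real.exp (-((τ - 1) * h)) * (Real.exp (1 - x) * (1 + τ * (x - 1) ^ 2)) := by
        rw [e1]; ring
    _ ≤ x * Real.exp (-((τ - 1) * h)) * (4 * Real.exp 1 * (1 + (τ - 1) * h)) := by gcongr
    _ = x * (4 * Real.exp 1) * ((1 + (τ - 1) * h) * Real.exp (-((τ - 1) * h))) := by ring
    _ ≤ x * (4 * Real.exp 1) * 1 := by gcongr
    _ = _ := by ring

/-- The concave part of the Green kernel, with the weights `t⁻¹` and `s⁻¹`, is controlled by a
convolution kernel at scale `τ^(-1/2)`. -/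
lemma abs_inv_mul_exp_mul_abs_inv_le {τ s t : ℝ} (hτ : 2 ≤ τ) (hs : s ≤ -1) (ht : t ≤ -1) :
    |t|⁻¹ * Real.exp (-τ * (s / t - 1 - Real.log (s / t))) * |s|⁻¹ ≤
      4 * Real.exp 1 * (1 + τ * (t - s) ^ 2)⁻¹ := by
  have hx : 0 < s / t := div_pos_of_neg_of_neg (by linarith) (by linarith)
  have h := exp_neg_mul_le hτ hx
  set x := s / t with hxdef
  have hst : s = x * t := by rw [hxdef, div_mul_cancel₀]; linarith
  have ht2 : 1 ≤ t ^ 2 := by nlinarith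
  have habs : |t|⁻¹ * |s|⁻¹ = (x * t ^ 2)⁻¹ := by
    rw [← mul_inv, ← abs_mul, hst, abs_of_pos]
    · ring
    · nlinarith
  have hle : 1 + τ * (t - s) ^ 2 ≤ t ^ 2 * (1 + τ * (x - 1) ^ 2) := by
    rw [hst]; nlinarith
  calc |t|⁻¹ * Real.exp (-τ * (x - 1 - Real.log x)) * |s|⁻¹
      = Real.exp (-τ * (x - 1 - Real.log x)) * (x * t ^ 2)⁻¹ := by rw [← habs]; ring
    _ ≤ _ := by
      rw [← div_eq_mul_inv, ← div_eq_mul_inv, div_le_div_iff₀ (by positivity) (by positivity)]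
      calc _ ≤ Real.exp (-τ * (x - 1 - Real.log x)) * (t ^ 2 * (1 + τ * (x - 1) ^ 2)) := by
            gcongr
        _ = t ^ 2 * (Real.exp (-τ * (x - 1 - Real.log x)) * (1 + τ * (x - 1) ^ 2)) := by ring
        _ ≤ t ^ 2 * (4 * Real.exp 1 * x) := by gcongr
        _ = _ := by ring

/-- Exponential decay in frequency, in terms of a geometric sequence of ratio close to `1`. -/
lemma exp_neg_two_mul_le {u κ : ℝ} (hu : 0 < u) (k : ℤ) :
    Real.exp (-(|κ - k| * u)) ^ 2 ≤
      2 * ((1 + u) / (1 + 2 * u)) ^ (k - ⌊κ⌋).natAbs := by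
  set ρ := (1 + u) / (1 + 2 * u) with hρ
  have hρ0 : 0 < ρ := by positivity
  have hρ2 : 1 / 2 ≤ ρ := by rw [hρ, div_le_div_iff₀ (by positivity) (by positivity)]; linarith
  have hρ1 : ρ ≤ 1 := by rw [hρ, div_le_one (by positivity)]; linarith
  have h1 : Real.exp (-u) ≤ ρ := by
    rw [Real.exp_neg, inv_le_comm₀ (Real.exp_pos _) hρ0]
    refine le_trans ?_ (Real.add_one_le_exp u)
    rw [hρ, inv_div, div_le_iff₀ (by positivity)]
    nlinarith
  have h2 : Real.exp (-(|κ - k| * u)) ≤ ρ ^ |κ - k| := by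
    calc Real.exp (-(|κ - k| * u)) = Real.exp (-u) ^ |κ - k| := by
          rw [← Real.exp_mul]; ring_nf
      _ ≤ _ := by gcongr
  have h3 : Real.exp (-(|κ - k| * u)) ≤ 1 := Real.exp_le_one_iff.2 (by simp; positivity)
  have hn : ((k - ⌊κ⌋).natAbs : ℝ) - 1 ≤ |κ - k| := by
    have e : ((k - ⌊κ⌋).natAbs : ℝ) = |(k : ℝ) - ⌊κ⌋| := by
      rw [← Int.cast_sub, ← Int.cast_abs, ← Int.natCast_natAbs, Int.cast_natCast]
    rw [e]
    have h4 : |(k : ℝ) - ⌊κ⌋| ≤ |(k : ℝ) - κ| + |κ - ⌊κ⌋| := abs_sub_le _ _ _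
    have h5 : |κ - ⌊κ⌋| ≤ 1 := by
      rw [abs_of_nonneg (by linarith [Int.floor_le κ])]
      linarith [Int.lt_floor_add_one κ]
    rw [abs_sub_comm (k : ℝ) κ] at h4
    linarith
  calc Real.exp (-(|κ - k| * u)) ^ 2 ≤ Real.exp (-(|κ - k| * u)) := by
        rw [sq]; exact mul_le_of_le_one_right (Real.exp_pos _).le h3
    _ ≤ ρ ^ (((k - ⌊κ⌋).natAbs : ℝ) - 1) :=
        h2.trans (Real.rpow_le_rpow_of_exponent_ge hρ0 hρ1 hn)
    _ = ρ ^ (k - ⌊κ⌋).natAbs * ρ⁻¹ := by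
        rw [Real.rpow_sub_one hρ0.ne', Real.rpow_natCast, div_eq_mul_inv]
    _ ≤ ρ ^ (k - ⌊κ⌋).natAbs * 2 := by
        gcongr
        rw [inv_le_comm₀ hρ0 (by norm_num)]; linarith
    _ = _ := by ring

lemma one_add_div_one_sub_le {u : ℝ} (hu : 0 < u) :
    (1 + (1 + u) / (1 + 2 * u)) / (1 - (1 + u) / (1 + 2 * u)) ≤ 4 * (1 + 1 / u) := by
  have e : (1 + (1 + u) / (1 + 2 * u)) / (1 - (1 + u) / (1 + 2 * u)) = (2 + 3 * u) / u := by
    have h1 : 1 - (1 + u) / (1 + 2 * u) = u / (1 + 2 * u) := by field_simp; ring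
    rw [h1]; field_simp; ring
  rw [e, div_le_iff₀ hu]
  have : 4 * (1 + 1 / u) * u = 4 * u + 4 := by field_simp
  rw [this]; linarith

/-- The model convolution kernel in the variable `t`. -/
def modelKernel (α x : ℝ) : ℝ := (1 + x ^ 2)⁻¹ * (1 + 1 / |x|) ^ α

lemma measurable_modelKernel (α : ℝ) : Measurable (modelKernel α) := by
  unfold modelKernel
  fun_prop

lemma modelKernel_nonneg (α x : ℝ) : 0 ≤ modelKernel α x := by
  unfold modelKernel
  positivity

lemma lintegral_modelKernel_rpow_lt_top {α r : ℝ} (hα : 0 ≤ α) (hr : 1 ≤ r) (hαr : α * r < 1) :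
    ∫⁻ x, ENNReal.ofReal (modelKernel α x) ^ r < ∞ := by
  have hβ : 0 ≤ α * r := by positivity
  have hint : Integrable (fun x : ℝ => 2 * (1 + x ^ 2)⁻¹ +
      2 * (Set.Icc (-1 : ℝ) 1).indicator (fun x => |x| ^ (-(α * r))) x) := by
    refine (integrable_inv_one_add_sq.const_mul 2).add (Integrable.const_mul ?_ 2)
    rw [integrable_indicator_iff measurableSet_Icc]
    have h1 : IntegrableOn (fun x : ℝ => |x| ^ (-(α * r))) (Set.Ioc 0 1) := by
      have := (intervalIntegral.intervalIntegrable_rpow' (a := 0) (b := 1)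
        (by linarith : -1 < -(α * r))).1
      refine this.congr_fun (fun x hx => ?_) measurableSet_Ioc
      simp only [abs_of_pos hx.1]
    have h1' : IntegrableOn (fun x : ℝ => |x| ^ (-(α * r))) (Set.Icc 0 1) :=
      (integrableOn_Icc_iff_integrableOn_Ioc (by simp)).2 h1
    have h2 : IntegrableOn (fun x : ℝ => |x| ^ (-(α * r))) (Set.Icc (-1) 0) := by
      have := h1'.comp_neg
      simpa using this
    exact (h2.union h1').mono_set (by rw [Set.Icc_union_Icc_eq_Icc] <;> norm_num)
  refine lt_of_le_of_lt (lintegral_mono_ae ?_) hint.lintegral_lt_top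
  filter_upwards [Measure.ae_ne volume (0 : ℝ)] with x hx
  rw [ENNReal.ofReal_rpow_of_nonneg (modelKernel_nonneg _ _) (by linarith)]
  refine ENNReal.ofReal_le_ofReal ?_
  have hx0 : 0 < |x| := abs_pos.2 hx
  have hinv0 : 0 < (1 + x ^ 2)⁻¹ := by positivity
  have hinv1 : (1 + x ^ 2)⁻¹ ≤ 1 := inv_le_one_of_one_le₀ (by nlinarith)
  have h2β : (2 : ℝ) ^ (α * r) ≤ 2 := by
    simpa using Real.rpow_le_rpow_of_exponent_le (by norm_num : (1 : ℝ) ≤ 2) hαr.le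
  have hstart : modelKernel α x ^ r ≤ (1 + x ^ 2)⁻¹ * (1 + 1 / |x|) ^ (α * r) := by
    unfold modelKernel
    rw [Real.mul_rpow hinv0.le (by positivity), ← Real.rpow_mul (by positivity)]
    gcongr
    simpa using Real.rpow_le_rpow_of_exponent_ge hinv0 hinv1 hr
  refine hstart.trans ?_
  rcases le_or_gt |x| 1 with h | h
  · rw [Set.indicator_of_mem (Set.mem_Icc.2 (abs_le.1 h))]
    have : (1 + 1 / |x|) ^ (α * r) ≤ 2 * |x| ^ (-(α * r)) := by
      calc (1 + 1 / |x|) ^ (α * r) ≤ (2 * |x|⁻¹) ^ (α * r) := by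
            gcongr
            have : 1 ≤ |x|⁻¹ := (one_le_inv₀ hx0).2 h
            rw [one_div]; linarith
        _ = 2 ^ (α * r) * |x| ^ (-(α * r)) := by
            rw [Real.mul_rpow (by norm_num) (by positivity), Real.inv_rpow hx0.le,
              Real.rpow_neg hx0.le]
        _ ≤ _ := by gcongr
    calc _ ≤ 1 * (2 * |x| ^ (-(α * r))) := by gcongr
      _ ≤ _ := by rw [one_mul]; linarith
  · have : (1 + 1 / |x|) ^ (α * r) ≤ 2 := by
      refine le_trans ?_ h2β
      gcongr
      have : |x|⁻¹ ≤ 1 := inv_le_one_of_one_le₀ h.le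
      rw [one_div]; linarith
    have h3 : 0 ≤ (Set.Icc (-1 : ℝ) 1).indicator (fun x => |x| ^ (-(α * r))) x :=
      Set.indicator_nonneg (fun x _ => by positivity) x
    calc _ ≤ (1 + x ^ 2)⁻¹ * 2 := by gcongr
      _ ≤ _ := by linarith

/-- Minkowski's integral inequality for finite `ℓ²` sums. -/
lemma sum_sq_rpow_half_le_lintegral {α ι : Type*} [MeasurableSpace α] {ν : Measure α}
    (F : Finset ι) {c : ι → ℝ≥0∞} (hfin : ∀ k ∈ F, c k ≠ ∞) {H : ι → α → ℝ≥0∞}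
    (hH : ∀ k, Measurable (H k)) (hc : ∀ k ∈ F, c k ≤ ∫⁻ s, H k s ∂ν) :
    (∑ k ∈ F, c k ^ (2 : ℝ)) ^ (1 / 2 : ℝ) ≤
      ∫⁻ s, (∑ k ∈ F, H k s ^ (2 : ℝ)) ^ (1 / 2 : ℝ) ∂ν := by
  set W := (∑ k ∈ F, c k ^ (2 : ℝ)) ^ (1 / 2 : ℝ) with hW
  rcases eq_or_ne W 0 with h0 | h0
  · rw [h0]; exact zero_le
  have hWfin : W ≠ ∞ := by
    refine (ENNReal.rpow_lt_top_of_nonneg (by norm_num) ?_).ne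
    exact (ENNReal.sum_lt_top.2 fun k hk =>
      ENNReal.rpow_lt_top_of_nonneg (by norm_num) (hfin k hk)).ne
  refine (ENNReal.mul_le_mul_iff_right h0 hWfin).1 ?_
  calc W * W = ∑ k ∈ F, c k ^ (2 : ℝ) := by
        rw [← sq, hW, ← ENNReal.rpow_two, ← ENNReal.rpow_mul]; norm_num
    _ ≤ ∑ k ∈ F, c k * ∫⁻ s, H k s ∂ν := by
        refine Finset.sum_le_sum fun k hk => ?_
        rw [ENNReal.rpow_two, sq]
        gcongr
        exact hc k hk
    _ = ∫⁻ s, ∑ k ∈ F, c k * H k s ∂ν := by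
        rw [lintegral_finsetSum _ fun k _ => (hH k).const_mul _]
        exact Finset.sum_congr rfl fun k _ => (lintegral_const_mul _ (hH k)).symm
    _ ≤ ∫⁻ s, W * (∑ k ∈ F, H k s ^ (2 : ℝ)) ^ (1 / 2 : ℝ) ∂ν :=
        lintegral_mono fun s => ENNReal.inner_le_Lp_mul_Lq F c (fun k => H k s)
          Real.HolderConjugate.two_two
    _ = W * ∫⁻ s, (∑ k ∈ F, H k s ^ (2 : ℝ)) ^ (1 / 2 : ℝ) ∂ν := lintegral_const_mul' _ _ hWfin

lemma measurable_Ltau {v : ℝ × ℝ → ℂ} (hv : ContDiff ℝ (⊤ : ℕ∞) v) (τ : ℝ) :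
    Measurable (Ltau τ v) := by
  have h0 := hv.continuous.measurable
  have h1 := (continuous_dT hv).measurable
  have h2 := (continuous_dTh hv).measurable
  unfold Ltau
  fun_prop

lemma continuous_Ltau_slice {v : ℝ × ℝ → ℂ} (hv : ContDiff ℝ (⊤ : ℕ∞) v) (τ s : ℝ) :
    Continuous fun θ => Ltau τ v (s, θ) := by
  have h0 := hv.continuous
  have h1 := continuous_dT hv
  have h2 := continuous_dTh hv
  change Continuous fun θ => dT v (s, θ) + Complex.I * dTh v (s, θ) +
    ((τ * (1 + 1 / s) : ℝ) : ℂ) * v (s, θ)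
  fun_prop

/-- Rescaled model kernel dominating the Green kernels of all Fourier modes. -/
def dominatingKernel (α τ x : ℝ) : ℝ :=
  8 * Real.exp 1 * τ ^ (α / 2) * modelKernel α (√τ * x)

lemma weighted_kernel_le {α τ s t : ℝ} (hα : 0 ≤ α) (hτ : 2 ≤ τ) (hs : s ≤ -1) (ht : t ≤ -1)
    (hst : s ≠ t) :
    |t|⁻¹ * (2 * Real.exp (-τ * (s / t - 1 - Real.log (s / t))) * (1 + 1 / |s - t|) ^ α) ≤
      dominatingKernel α τ (t - s) * |s| := by
  have hu : 0 < |s - t| := abs_pos.2 (sub_ne_zero.2 hst)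
  have hs0 : 0 < |s| := abs_pos.2 (by linarith)
  have hτ0 : 0 < τ := by linarith
  have hsq : 1 ≤ √τ := Real.one_le_sqrt.2 (by linarith)
  have h1 := abs_inv_mul_exp_mul_abs_inv_le hτ hs ht
  have h2 : (1 + 1 / |s - t|) ^ α ≤ τ ^ (α / 2) * (1 + 1 / |√τ * (t - s)|) ^ α := by
    have e : τ ^ (α / 2) = √τ ^ α := by
      rw [Real.sqrt_eq_rpow, ← Real.rpow_mul hτ0.le]; congr 1; ring
    rw [e, ← Real.mul_rpow (by positivity) (by positivity)]
    gcongr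
    rw [abs_mul, abs_of_pos (by positivity : 0 < √τ), abs_sub_comm t s]
    have : √τ * (1 + 1 / (√τ * |s - t|)) = √τ + 1 / |s - t| := by field_simp
    rw [this]; linarith
  calc |t|⁻¹ * (2 * Real.exp (-τ * (s / t - 1 - Real.log (s / t))) * (1 + 1 / |s - t|) ^ α)
      = (|t|⁻¹ * Real.exp (-τ * (s / t - 1 - Real.log (s / t))) * |s|⁻¹) * 2 *
        (1 + 1 / |s - t|) ^ α * |s| := by field_simp
    _ ≤ (4 * Real.exp 1 * (1 + τ * (t - s) ^ 2)⁻¹) * 2 *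
        (τ ^ (α / 2) * (1 + 1 / |√τ * (t - s)|) ^ α) * |s| := by gcongr
    _ = _ := by
        unfold dominatingKernel modelKernel
        rw [mul_pow, Real.sq_sqrt hτ0.le]
        ring

/-- The `ℓ²` norm of the Green kernels acting on the Fourier modes of a time slice. -/
lemma sum_kernel_sq_le {p : ℝ} (hp1 : 1 < p) (hp2 : p ≤ 2) {g : ℝ → ℂ} (hg : Continuous g)
    (F : Finset ℤ) {u κ : ℝ} (hu : 0 < u) (y : ℝ) :
    ∑ k ∈ F, (ENNReal.ofReal (Real.exp (-(|κ - k| * u) - y)) *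
        ‖(1 / (2 * Real.pi) : ℂ) * fourierInt g k‖ₑ) ^ (2 : ℝ) ≤
      (ENNReal.ofReal (2 * Real.exp (-y) * (1 + 1 / u) ^ (1 / p - 1 / 2)) *
        (∫⁻ θ, ‖g θ‖ₑ ^ p ∂circleMeasure) ^ (1 / p)) ^ (2 : ℝ) := by
  have hp0 : 0 < p := by linarith
  set ρ := (1 + u) / (1 + 2 * u) with hρ
  have hρ0 : 0 ≤ ρ := by positivity
  have hρ1 : ρ < 1 := by rw [hρ, div_lt_one (by positivity)]; linarith
  have ha : 0 ≤ 2 / p - 1 := by rw [sub_nonneg, le_div_iff₀ hp0]; linarith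
  have hb : 0 ≤ 2 - 2 / p := by rw [sub_nonneg, div_le_iff₀ hp0]; linarith
  have hB := sum_pow_natAbs_sub_mul_norm_sq_le hp1 hp2 hρ0 hρ1 hg F ⌊κ⌋
  set B := ∫⁻ θ, ‖g θ‖ₑ ^ p ∂circleMeasure
  have hpi := Real.pi_gt_three
  have hterm : ∀ k : ℤ, (ENNReal.ofReal (Real.exp (-(|κ - k| * u) - y)) *
      ‖(1 / (2 * Real.pi) : ℂ) * fourierInt g k‖ₑ) ^ (2 : ℝ) =
      ENNReal.ofReal (Real.exp (-y) ^ 2 * (1 / (2 * Real.pi)) ^ 2 *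
        (Real.exp (-(|κ - k| * u)) ^ 2 * ‖fourierInt g k‖ ^ 2)) := by
    intro k
    rw [← ofReal_norm, ← ENNReal.ofReal_mul (Real.exp_pos _).le, ENNReal.rpow_two,
      ← ENNReal.ofReal_pow (by positivity)]
    congr 1
    rw [norm_mul, sub_eq_add_neg, Real.exp_add]
    have : ‖(1 / (2 * Real.pi) : ℂ)‖ = 1 / (2 * Real.pi) := by
      rw [norm_div, norm_mul, Complex.norm_real, Real.norm_of_nonneg Real.pi_pos.le]
      simp
    rw [this]
    ring
  simp_rw [hterm]
  rw [← ENNReal.ofReal_sum_of_nonneg fun k _ => by positivity]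
  calc ENNReal.ofReal (∑ k ∈ F, Real.exp (-y) ^ 2 * (1 / (2 * Real.pi)) ^ 2 *
        (Real.exp (-(|κ - k| * u)) ^ 2 * ‖fourierInt g k‖ ^ 2))
      ≤ ENNReal.ofReal (∑ k ∈ F, Real.exp (-y) ^ 2 * (1 / (2 * Real.pi)) ^ 2 *
        ((2 * ρ ^ (k - ⌊κ⌋).natAbs) * ‖fourierInt g k‖ ^ 2)) := by
        gcongr with k hk
        exact exp_neg_two_mul_le hu k
    _ = ENNReal.ofReal (Real.exp (-y) ^ 2 * (1 / (2 * Real.pi)) ^ 2 * 2) *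
        ENNReal.ofReal (∑ k ∈ F, ρ ^ (k - ⌊κ⌋).natAbs * ‖fourierInt g k‖ ^ 2) := by
        rw [← ENNReal.ofReal_mul (by positivity), Finset.mul_sum]
        congr 1
        exact Finset.sum_congr rfl fun k _ => by ring
    _ ≤ ENNReal.ofReal (Real.exp (-y) ^ 2 * (1 / (2 * Real.pi)) ^ 2 * 2) *
        (ENNReal.ofReal (4 * (1 + 1 / u)) ^ (2 / p - 1) *
          ENNReal.ofReal (2 * Real.pi) ^ (2 - 2 / p) * B ^ (2 / p)) := by
        gcongr
        refine hB.trans ?_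
        gcongr
        exact one_add_div_one_sub_le hu
    _ = ENNReal.ofReal (Real.exp (-y) ^ 2 * (1 / (2 * Real.pi)) ^ 2 * 2 *
        ((4 * (1 + 1 / u)) ^ (2 / p - 1) * (2 * Real.pi) ^ (2 - 2 / p))) * B ^ (2 / p) := by
        rw [ENNReal.ofReal_rpow_of_nonneg (by positivity) ha,
          ENNReal.ofReal_rpow_of_nonneg (by positivity) hb, ← ENNReal.ofReal_mul (by positivity),
          ← mul_assoc, ← ENNReal.ofReal_mul (by positivity)]
    _ ≤ ENNReal.ofReal ((2 * Real.exp (-y) * (1 + 1 / u) ^ (1 / p - 1 / 2)) ^ (2 : ℝ)) *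
        B ^ (2 / p) := by
        gcongr
        have h4 : (4 : ℝ) ^ (2 / p - 1) ≤ 4 := by
          refine (Real.rpow_le_rpow_of_exponent_le (by norm_num) ?_).trans_eq (Real.rpow_one 4)
          linarith
        have h5 : (2 * Real.pi) ^ (2 - 2 / p) ≤ 2 * Real.pi := by
          refine (Real.rpow_le_rpow_of_exponent_le (by linarith) ?_).trans_eq (Real.rpow_one _)
          linarith
        have h6 : ((1 + 1 / u) ^ (1 / p - 1 / 2)) ^ 2 = (1 + 1 / u) ^ (2 / p - 1) := by
          rw [← Real.rpow_natCast, ← Real.rpow_mul (by positivity)]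
          congr 1; push_cast; ring
        rw [Real.rpow_two, mul_pow, mul_pow, h6, Real.mul_rpow (by norm_num) (by positivity)]
        calc _ ≤ Real.exp (-y) ^ 2 * (1 / (2 * Real.pi)) ^ 2 * 2 *
              (4 * (1 + 1 / u) ^ (2 / p - 1) * (2 * Real.pi)) := by gcongr
          _ = (4 / Real.pi) * (Real.exp (-y) ^ 2 * (1 + 1 / u) ^ (2 / p - 1)) := by
              field_simp
          _ ≤ 4 * (Real.exp (-y) ^ 2 * (1 + 1 / u) ^ (2 / p - 1)) := by
              gcongr
              rw [div_le_iff₀ Real.pi_pos]; linarith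
          _ = _ := by ring
    _ = _ := by
        rw [ENNReal.mul_rpow_of_nonneg _ _ (by norm_num), ← ENNReal.rpow_mul,
          ENNReal.ofReal_rpow_of_nonneg (by positivity) (by norm_num)]
        congr 2
        ring

lemma dominatingKernel_nonneg {α τ : ℝ} (hτ : 0 ≤ τ) (x : ℝ) : 0 ≤ dominatingKernel α τ x := by
  have := modelKernel_nonneg α (√τ * x)
  unfold dominatingKernel
  positivity

lemma measurable_dominatingKernel (α τ : ℝ) : Measurable (dominatingKernel α τ) := by
  have := measurable_modelKernel α
  unfold dominatingKernel
  fun_prop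

lemma lintegral_dominatingKernel_rpow {α τ r : ℝ} (hτ : 0 < τ) (hr : 0 ≤ r) :
    ∫⁻ x, ENNReal.ofReal (dominatingKernel α τ x) ^ r =
      ENNReal.ofReal ((8 * Real.exp 1 * τ ^ (α / 2)) ^ r * τ ^ (-(1 / 2) : ℝ)) *
        ∫⁻ x, ENNReal.ofReal (modelKernel α x) ^ r := by
  have hs : √τ ≠ 0 := (Real.sqrt_pos.2 hτ).ne'
  have hmeas : Measurable fun x => ENNReal.ofReal (modelKernel α x) ^ r :=
    (measurable_modelKernel α).ennreal_ofReal.pow_const r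
  have hscale : ∫⁻ x, ENNReal.ofReal (modelKernel α (√τ * x)) ^ r =
      ENNReal.ofReal (τ ^ (-(1 / 2) : ℝ)) * ∫⁻ x, ENNReal.ofReal (modelKernel α x) ^ r := by
    rw [← lintegral_map (μ := volume) hmeas (measurable_const_mul √τ),
      Real.map_volume_mul_left hs, lintegral_smul_measure, abs_of_nonneg (by positivity),
      Real.rpow_neg hτ.le, ← Real.sqrt_eq_rpow, smul_eq_mul]
  have h0 : 0 ≤ 8 * Real.exp 1 * τ ^ (α / 2) := by positivity
  rw [ENNReal.ofReal_mul (by positivity), mul_assoc, ← hscale,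
    ← lintegral_const_mul' _ _ ENNReal.ofReal_ne_top]
  refine lintegral_congr fun x => ?_
  rw [dominatingKernel, ENNReal.ofReal_mul h0, ENNReal.mul_rpow_of_nonneg _ _ hr,
    ENNReal.ofReal_rpow_of_nonneg h0 hr]

lemma fcT_eq_zero {v : ℝ × ℝ → ℂ} {t : ℝ} (h : ∀ θ, v (t, θ) = 0) (k : ℤ) : fcT v k t = 0 := by
  simp [fcT, h]

/-- Bound for the low Fourier modes of a time slice by a convolution in time. -/
lemma slice_le_convolution {p : ℝ} (hp1 : 1 < p) (hp2 : p ≤ 2) {τ : ℝ} (hτ : 2 ≤ τ)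
    {v : ℝ × ℝ → ℂ} (hv : ContDiff ℝ (⊤ : ℕ∞) v)
    (hper : ∀ t θ : ℝ, v (t, θ + 2 * Real.pi) = v (t, θ))
    {a : ℝ} (hsupp : ∀ q : ℝ × ℝ, v q ≠ 0 → a < q.1 ∧ q.1 < -1) (F : Finset ℤ) {t : ℝ}
    (ht : t < -1) :
    ‖t⁻¹‖ₑ * (∑ k ∈ F, ‖fcT v k t‖ₑ ^ (2 : ℝ)) ^ (1 / 2 : ℝ) ≤
      ∫⁻ s, ENNReal.ofReal (dominatingKernel (1 / p - 1 / 2) τ (t - s)) *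
        (Set.Iic (-1)).indicator
          (fun s => ‖s‖ₑ * (∫⁻ θ, ‖Ltau τ v (s, θ)‖ₑ ^ p ∂circleMeasure) ^ (1 / p)) s := by
  have hp0 : 0 < p := by linarith
  have hzero : ∀ k, ∀ s, s ≤ a ∨ -1 ≤ s → fcT v k s = 0 := fun k s hs =>
    fcT_eq_zero (fun θ => by
      by_contra h
      have := hsupp _ h
      rcases hs with hs | hs <;> simp only at this <;> linarith [this.1, this.2]) k
  set H : ℤ → ℝ → ℝ≥0∞ := fun k s =>
    ENNReal.ofReal (Real.exp (-(|τ * (1 + 1 / t) - k| * |s - t|) -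
      τ * (s / t - 1 - Real.log (s / t)))) * ‖fcT (Ltau τ v) k s‖ₑ with hH
  have hode : ∀ k ∈ F, ‖fcT v k t‖ₑ ≤ ∫⁻ s in Set.Iic (-1), H k s := by
    intro k _
    have h := enorm_le_lintegral_of_ode (τ := τ) k (w := fcT v k) (w' := fcT (dT v) k)
      (A := a) (hasDerivAt_fcT hv k) (continuous_fcT (continuous_dT hv) k)
      (fun s hs => hzero k s (Or.inl hs)) (fun s hs => hzero k s (Or.inr hs)) ht
    simpa only [hH, fcT_Ltau hv hper] using h
  have hHm : ∀ k, Measurable (H k) := by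
    intro k
    have h1 := (continuous_fcT (continuous_dT hv) k).measurable
    have h2 := (continuous_fcT hv.continuous k).measurable
    simp only [hH, fcT_Ltau hv hper]
    fun_prop
  calc ‖t⁻¹‖ₑ * (∑ k ∈ F, ‖fcT v k t‖ₑ ^ (2 : ℝ)) ^ (1 / 2 : ℝ)
      ≤ ‖t⁻¹‖ₑ * ∫⁻ s in Set.Iic (-1), (∑ k ∈ F, H k s ^ (2 : ℝ)) ^ (1 / 2 : ℝ) := by
        gcongr
        exact sum_sq_rpow_half_le_lintegral F (fun _ _ => enorm_ne_top) hHm hode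
    _ = ∫⁻ s in Set.Iic (-1), ‖t⁻¹‖ₑ * (∑ k ∈ F, H k s ^ (2 : ℝ)) ^ (1 / 2 : ℝ) :=
        (lintegral_const_mul' _ _ enorm_ne_top).symm
    _ ≤ ∫⁻ s in Set.Iic (-1), ENNReal.ofReal (dominatingKernel (1 / p - 1 / 2) τ (t - s)) *
        (‖s‖ₑ * (∫⁻ θ, ‖Ltau τ v (s, θ)‖ₑ ^ p ∂circleMeasure) ^ (1 / p)) := by
        refine lintegral_mono_ae ?_
        filter_upwards [ae_restrict_mem measurableSet_Iic,
          ae_restrict_of_ae (Measure.ae_ne volume t)] with s hs hst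
        have hα : 0 ≤ 1 / p - 1 / 2 := by
          rw [sub_nonneg]; exact one_div_le_one_div_of_le hp0 hp2
        have hN := dominatingKernel_nonneg (α := 1 / p - 1 / 2) (by linarith : 0 ≤ τ) (t - s)
        have h1 := sum_kernel_sq_le hp1 hp2 (continuous_Ltau_slice hv τ s) F
          (κ := τ * (1 + 1 / t)) (abs_pos.2 (sub_ne_zero.2 hst))
          (τ * (s / t - 1 - Real.log (s / t)))
        have h2 := ENNReal.rpow_le_rpow h1 (by norm_num : (0 : ℝ) ≤ 1 / 2)
        rw [← ENNReal.rpow_mul, mul_one_div_cancel two_ne_zero, ENNReal.rpow_one] at h2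
        have h3 := weighted_kernel_le hα hτ hs ht.le hst
        refine (mul_le_mul_right h2 _).trans ?_
        rw [← mul_assoc, ← mul_assoc]
        refine mul_le_mul_left ?_ _
        rw [← ofReal_norm, ← ofReal_norm, ← ENNReal.ofReal_mul (norm_nonneg _),
          ← ENNReal.ofReal_mul hN, Real.norm_eq_abs, Real.norm_eq_abs, abs_inv]
        refine ENNReal.ofReal_le_ofReal (le_of_eq_of_le ?_ h3)
        rw [neg_mul]
    _ = _ := by
        rw [← lintegral_indicator measurableSet_Iic]
        refine lintegral_congr fun s => ?_
        by_cases h : s ∈ Set.Iic (-1 : ℝ) <;> simp [h]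

lemma restrict_stripe :
    (volume : Measure (ℝ × ℝ)).restrict stripe = (volume : Measure ℝ).prod circleMeasure := by
  rw [stripe, Measure.volume_eq_prod, ← Measure.prod_restrict, Measure.restrict_univ]

/-- The square of an `L²` norm on the stripe, computed on the modes. -/
lemma lintegral_Pl_sq_le {v : ℝ × ℝ → ℂ} (hv : Continuous v) (τ : ℝ) :
    ∫⁻ q, ‖((q.1⁻¹ : ℝ) : ℂ) * Pl τ v q‖ₑ ^ (2 : ℝ) ∂(volume.restrict stripe) =
      ENNReal.ofReal (2 * Real.pi) * ∫⁻ t : ℝ, (‖t⁻¹‖ₑ *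
        (∑ k ∈ Finset.Icc (0 : ℤ) ⌈2 * τ⌉, ‖fcT v k t‖ₑ ^ (2 : ℝ)) ^ (1 / 2 : ℝ)) ^ (2 : ℝ) := by
  have hm : Measurable fun q : ℝ × ℝ => ‖((q.1⁻¹ : ℝ) : ℂ) * Pl τ v q‖ₑ ^ (2 : ℝ) := by
    have h := fun k => (continuous_fcT hv k).measurable
    unfold Pl Pk
    fun_prop
  rw [restrict_stripe, lintegral_prod _ hm.aemeasurable,
    ← lintegral_const_mul' _ _ ENNReal.ofReal_ne_top]
  refine lintegral_congr fun t => ?_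
  simp only [enorm_mul, ENNReal.mul_rpow_of_nonneg _ _ (zero_le_two : (0 : ℝ) ≤ 2)]
  rw [lintegral_const_mul' _ _ (ENNReal.rpow_lt_top_of_nonneg zero_le_two enorm_ne_top).ne]
  simp only [Pl, Pk]
  rw [lintegral_enorm_sum_exp_sq, ENNReal.ofReal_mul (by positivity),
    ENNReal.ofReal_sum_of_nonneg fun k _ => by positivity, ← ENNReal.rpow_mul]
  have h : ∀ z : ℂ, ENNReal.ofReal (‖z‖ ^ 2) = ‖z‖ₑ ^ (2 : ℝ) := fun z => by
    rw [ENNReal.ofReal_pow (norm_nonneg _), ofReal_norm, ENNReal.rpow_two]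
  have h' : ‖((t⁻¹ : ℝ) : ℂ)‖ₑ = ‖t⁻¹‖ₑ := by
    rw [← ofReal_norm, ← ofReal_norm, Complex.norm_real]
  simp only [h, h']
  norm_num
  ring

lemma lintegral_dominatingKernel_rpow_inv {α τ r : ℝ} (hτ : 0 < τ) (hr : 0 < r) :
    (∫⁻ x, ENNReal.ofReal (dominatingKernel α τ x) ^ r) ^ (1 / r) =
      ENNReal.ofReal (8 * Real.exp 1 * τ ^ (α / 2 - 1 / r / 2)) *
        (∫⁻ x, ENNReal.ofReal (modelKernel α x) ^ r) ^ (1 / r) := by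
  rw [lintegral_dominatingKernel_rpow hτ hr.le, ENNReal.mul_rpow_of_nonneg _ _ (by positivity),
    ENNReal.ofReal_rpow_of_nonneg (by positivity) (by positivity)]
  congr 2
  rw [Real.mul_rpow (by positivity) (by positivity), ← Real.rpow_mul (by positivity),
    ← Real.rpow_mul hτ.le, mul_one_div_cancel hr.ne', Real.rpow_one, mul_assoc, ← Real.rpow_add hτ]
  congr 2
  ring

/-- Tonelli on the stripe: the mixed norm of `t L_τ v` on `t ≤ -1` is at most the full norm. -/
lemma lintegral_indicator_rpow_le_eLpNorm {p : ℝ} (hp0 : 0 < p) {τ : ℝ} {v : ℝ × ℝ → ℂ}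
    (hv : ContDiff ℝ (⊤ : ℕ∞) v) :
    (∫⁻ s, (Set.Iic (-1)).indicator (fun s : ℝ => ‖s‖ₑ *
        (∫⁻ θ, ‖Ltau τ v (s, θ)‖ₑ ^ p ∂circleMeasure) ^ (1 / p)) s ^ p) ^ (1 / p) ≤
      eLpNorm (fun q : ℝ × ℝ => ((q.1 : ℝ) : ℂ) * Ltau τ v q)
        (ENNReal.ofReal p) (volume.restrict stripe) := by
  have hLm := measurable_Ltau hv τ
  rw [eLpNorm_eq_lintegral_rpow_enorm_toReal (by simpa using hp0) ENNReal.ofReal_ne_top,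
    ENNReal.toReal_ofReal hp0.le, restrict_stripe, lintegral_prod _ (by fun_prop)]
  refine ENNReal.rpow_le_rpow (lintegral_mono fun s => ?_) (by positivity)
  calc _ ≤ (‖s‖ₑ * (∫⁻ θ, ‖Ltau τ v (s, θ)‖ₑ ^ p ∂circleMeasure) ^ (1 / p)) ^ p :=
        ENNReal.rpow_le_rpow (Set.indicator_le_self _ _ s) hp0.le
    _ = ‖s‖ₑ ^ p * ∫⁻ θ, ‖Ltau τ v (s, θ)‖ₑ ^ p ∂circleMeasure := by
        rw [ENNReal.mul_rpow_of_nonneg _ _ hp0.le, ← ENNReal.rpow_mul,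
          one_div_mul_cancel hp0.ne', ENNReal.rpow_one]
    _ = ∫⁻ θ, ‖((s : ℝ) : ℂ) * Ltau τ v (s, θ)‖ₑ ^ p ∂circleMeasure := by
        rw [← lintegral_const_mul' _ _ (ENNReal.rpow_lt_top_of_nonneg hp0.le enorm_ne_top).ne]
        refine lintegral_congr fun θ => ?_
        rw [enorm_mul, ENNReal.mul_rpow_of_nonneg _ _ hp0.le, ← ofReal_norm, ← ofReal_norm (s : ℂ),
          Complex.norm_real]
    _ ≤ _ := le_rfl

/-- The bound for the low-frequency part in the Carleman estimate, with the
weights `t⁻¹` on the left and `t` on the right. -/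
theorem statement17 (p : ℝ) (hp1 : 1 < p) (hp2 : p ≤ 2) :
    ∃ t₀ < (0 : ℝ), ∃ τ₀ > (0 : ℝ), ∃ C > (0 : ℝ),
      ∀ τ : ℝ, τ₀ ≤ τ →
      ∀ v : ℝ × ℝ → ℂ, ContDiff ℝ (⊤ : ℕ∞) v →
        (∀ t θ : ℝ, v (t, θ + 2 * Real.pi) = v (t, θ)) →
        (∃ a : ℝ, ∀ q : ℝ × ℝ, v q ≠ 0 → a < q.1 ∧ q.1 < t₀) →
        eLpNorm (fun q : ℝ × ℝ => ((q.1⁻¹ : ℝ) : ℂ) * Pl τ v q) 2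
            (volume.restrict stripe) ≤
          ENNReal.ofReal (C * τ ^ (-1 + 1 / p)) *
            eLpNorm (fun q : ℝ × ℝ => ((q.1 : ℝ) : ℂ) * Ltau τ v q)
              (ENNReal.ofReal p) (volume.restrict stripe) := by
  have hp0 : 0 < p := by linarith
  set α := 1 / p - 1 / 2 with hα'
  have hα : 0 ≤ α := by
    rw [hα', sub_nonneg]; exact one_div_le_one_div_of_le hp0 hp2
  have hp1' : 1 / p < 1 := (div_lt_one hp0).2 hp1
  set r := (3 / 2 - 1 / p)⁻¹ with hr'
  have hr0 : 0 < r := inv_pos.2 (by linarith)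
  have hr : 1 ≤ r := (one_le_inv₀ (by linarith)).2 (by linarith)
  have hrinv : 1 / r = 3 / 2 - 1 / p := by rw [hr', one_div, inv_inv]
  have hαr : α * r < 1 := by
    rw [← lt_div_iff₀ hr0, hrinv]; linarith
  set M := (∫⁻ x, ENNReal.ofReal (modelKernel α x) ^ r) ^ (1 / r) with hM
  have hMfin : M ≠ ∞ := (ENNReal.rpow_lt_top_of_nonneg (by positivity)
    (lintegral_modelKernel_rpow_lt_top hα hr hαr).ne).ne
  refine ⟨-1, by norm_num, 2, by norm_num, √(2 * Real.pi) * (8 * Real.exp 1) * (M.toReal + 1),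
    by positivity, fun τ hτ v hv hper ⟨a, hsupp⟩ => ?_⟩
  have hτ0 : 0 < τ := by linarith
  set f : ℝ → ℝ≥0∞ := (Set.Iic (-1)).indicator fun s => ‖s‖ₑ *
    (∫⁻ θ, ‖Ltau τ v (s, θ)‖ₑ ^ p ∂circleMeasure) ^ (1 / p) with hf'
  set N : ℝ → ℝ≥0∞ := fun x => ENNReal.ofReal (dominatingKernel α τ x) with hN'
  have hN : Measurable N := (measurable_dominatingKernel α τ).ennreal_ofReal
  have hf : Measurable f := by
    have h : Measurable fun s : ℝ => ∫⁻ θ, ‖Ltau τ v (s, θ)‖ₑ ^ p ∂circleMeasure :=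
      ((measurable_Ltau hv τ).enorm.pow_const p).lintegral_prod_right'
    exact Measurable.indicator (by fun_prop) measurableSet_Iic
  have hslice : ∀ t : ℝ, ‖t⁻¹‖ₑ * (∑ k ∈ Finset.Icc (0 : ℤ) ⌈2 * τ⌉,
      ‖fcT v k t‖ₑ ^ (2 : ℝ)) ^ (1 / 2 : ℝ) ≤ ∫⁻ s, N (t - s) * f s := by
    intro t
    rcases lt_or_ge t (-1) with ht | ht
    · exact slice_le_convolution hp1 hp2 hτ hv hper hsupp _ ht
    · have h : ∀ k, fcT v k t = 0 := fcT_eq_zero fun θ => by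
        by_contra h
        exact absurd (hsupp _ h).2 (not_lt.2 ht)
      simp [h]
  rw [eLpNorm_eq_lintegral_rpow_enorm_toReal two_ne_zero ENNReal.ofNat_ne_top,
    ENNReal.toReal_ofNat, lintegral_Pl_sq_le hv.continuous]
  calc _ ≤ (ENNReal.ofReal (2 * Real.pi) *
        ((∫⁻ x, N x ^ r) ^ (2 / r) * (∫⁻ s, f s ^ p) ^ (2 / p))) ^ (1 / 2 : ℝ) := by
        refine ENNReal.rpow_le_rpow (mul_le_mul_right ?_ _) (by norm_num)
        refine le_trans (lintegral_mono fun t => ENNReal.rpow_le_rpow (hslice t) zero_le_two) ?_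
        exact lintegral_convolution_sq_le hp1 hp2 hr0 (by rw [hrinv]; ring) hN hf
    _ = ENNReal.ofReal √(2 * Real.pi) *
        ((∫⁻ x, N x ^ r) ^ (1 / r) * (∫⁻ s, f s ^ p) ^ (1 / p)) := by
        rw [ENNReal.mul_rpow_of_nonneg _ _ (by norm_num),
          ENNReal.mul_rpow_of_nonneg _ _ (by norm_num), ← ENNReal.rpow_mul, ← ENNReal.rpow_mul,
          ENNReal.ofReal_rpow_of_nonneg (by positivity) (by norm_num), ← Real.sqrt_eq_rpow]
        congr 3 <;> ring
    _ ≤ ENNReal.ofReal √(2 * Real.pi) *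
        ((ENNReal.ofReal (8 * Real.exp 1 * τ ^ (-1 + 1 / p)) * ENNReal.ofReal (M.toReal + 1)) *
          eLpNorm (fun q : ℝ × ℝ => ((q.1 : ℝ) : ℂ) * Ltau τ v q)
            (ENNReal.ofReal p) (volume.restrict stripe)) := by
        refine mul_le_mul_right (mul_le_mul' ?_ ?_) _
        · rw [lintegral_dominatingKernel_rpow_inv hτ0 hr0, hrinv]
          refine mul_le_mul' (le_of_eq ?_) ?_
          · congr 3
            rw [hα']; ring
          · rw [← hrinv, ← hM, ← ENNReal.ofReal_toReal hMfin]
            exact ENNReal.ofReal_le_ofReal (by simp)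
        · exact lintegral_indicator_rpow_le_eLpNorm hp0 hv
    _ = _ := by
        rw [← mul_assoc, ← ENNReal.ofReal_mul (by positivity),
          ← ENNReal.ofReal_mul (by positivity)]
        congr 2
        ring

end
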